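/- For every ε > 0 there exist δ > 0 and C ≥ 1 such that the following holds for all integers n ≥ 2 and m ≥ 1 with 1/2 ≤ (13/12)·(m/n) ≤ 1 − ε, every nonnegative integer a, and every real α > 0 with α ≥ C·a: there exists a real y with 1 < g_B(y) < y ≤ 2 and g_B(y)^α / y^{α − a} ≤ e^{−δ·α}, where g_B is the probability generating function of a random variable B with the mixed binomial distribution Bin(m, 2P/n). -/

import Mathlib

open MeasureTheory

/-- The point of the interval `[min(u,v), max(u,v)]` closest to `1/2`. -/
noncomputable def cmid (u v : ℝ) : ℝ := min (max (min u v) (1 / 2)) (max u v)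

/-- `P(u,v) = 1 − 2·c(u,v)·(1 − c(u,v))`, the random variable `P` as a function of the
two uniform endpoint samples. -/
noncomputable def Pfun (u v : ℝ) : ℝ := 1 - 2 * cmid u v * (1 - cmid u v)

/-- `P[B = k]` for a random variable `B` with the mixed binomial distribution
`Bin(m, 2P/n)`: `P[B = k] = E[ binom(m,k)·(2P/n)^k·(1 − 2P/n)^{m−k} ]`. -/
noncomputable def mixedBinomPMF (n m k : ℕ) : ℝ :=
  ∫ u in (0 : ℝ)..1, ∫ v in (0 : ℝ)..1,
    (Nat.choose m k : ℝ) * (2 * Pfun u v / n) ^ k * (1 - 2 * Pfun u v / n) ^ (m - k)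

/-- The probability generating function `g_B(y) = Σ_{k≥0} P[B = k]·y^k` of a random
variable `B` with the mixed binomial distribution `Bin(m, 2P/n)`. -/
noncomputable def mixedBinomPGF (n m : ℕ) (y : ℝ) : ℝ :=
  ∑' k : ℕ, mixedBinomPMF n m k * y ^ k

lemma cmid_mem {u v : ℝ} (hu : u ∈ Set.Icc (0:ℝ) 1) (hv : v ∈ Set.Icc (0:ℝ) 1) :
    cmid u v ∈ Set.Icc (0:ℝ) 1 := by
  obtain ⟨h1, h2⟩ := hu
  obtain ⟨h3, h4⟩ := hv
  unfold cmid
  constructor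
  · exact le_min (le_max_of_le_right (by norm_num)) (le_max_of_le_left h1)
  · exact min_le_of_right_le (max_le h2 h4)

lemma Pfun_mem {u v : ℝ} (hu : u ∈ Set.Icc (0:ℝ) 1) (hv : v ∈ Set.Icc (0:ℝ) 1) :
    1 / 2 ≤ Pfun u v ∧ Pfun u v ≤ 1 := by
  obtain ⟨h1, h2⟩ := cmid_mem hu hv
  unfold Pfun
  constructor
  · nlinarith [sq_nonneg (cmid u v - 1/2)]
  · nlinarith [mul_nonneg h1 (sub_nonneg.2 h2)]

lemma Pfun_cont : Continuous (fun p : ℝ × ℝ => Pfun p.1 p.2) := by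
  unfold Pfun cmid
  fun_prop

noncomputable def EE (F : ℝ → ℝ) : ℝ := ∫ u in (0 : ℝ)..1, ∫ v in (0 : ℝ)..1, F (Pfun u v)

lemma inner_cont {F : ℝ → ℝ} (hF : Continuous F) (u : ℝ) : Continuous (fun v => F (Pfun u v)) :=
  hF.comp (Pfun_cont.comp (by fun_prop : Continuous fun v : ℝ => (u, v)))

lemma outer_cont {F : ℝ → ℝ} (hF : Continuous F) :
    Continuous (fun u => ∫ v in (0 : ℝ)..1, F (Pfun u v)) :=
  intervalIntegral.continuous_parametric_intervalIntegral_of_continuous'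
    (f := fun u v => F (Pfun u v)) (hF.comp Pfun_cont) 0 1

lemma EE_mono {F G : ℝ → ℝ} (hF : Continuous F) (hG : Continuous G)
    (h : ∀ p, 1 / 2 ≤ p → p ≤ 1 → F p ≤ G p) : EE F ≤ EE G := by
  unfold EE
  refine intervalIntegral.integral_mono_on zero_le_one ((outer_cont hF).intervalIntegrable _ _)
    ((outer_cont hG).intervalIntegrable _ _) fun u hu => ?_
  refine intervalIntegral.integral_mono_on zero_le_one ((inner_cont hF u).intervalIntegrable _ _)
    ((inner_cont hG u).intervalIntegrable _ _) fun v hv => ?_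
  exact h _ (Pfun_mem hu hv).1 (Pfun_mem hu hv).2

lemma EE_sum {ι : Type*} (s : Finset ι) (F : ι → ℝ → ℝ) (hF : ∀ i, Continuous (F i)) :
    EE (fun p => ∑ i ∈ s, F i p) = ∑ i ∈ s, EE (F i) := by
  unfold EE
  rw [← intervalIntegral.integral_finsetSum
    (fun i _ => (outer_cont (hF i)).intervalIntegrable _ _)]
  congr 1
  ext u
  exact intervalIntegral.integral_finsetSum
    (fun i _ => (inner_cont (hF i) u).intervalIntegrable _ _)

lemma EE_mul (F : ℝ → ℝ) (c : ℝ) : EE (fun p => F p * c) = EE F * c := by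
  unfold EE
  simp only [intervalIntegral.integral_mul_const]

lemma EE_affine (b c : ℝ) : EE (fun p => c + p * b) = c + EE (fun p => p) * b := by
  have h := EE_sum Finset.univ (fun i : Bool => if i then (fun _ => c) else (fun p => p * b))
    (by intro i; cases i <;> simp <;> fun_prop)
  simp only [Fintype.univ_bool, Finset.sum_insert, Finset.mem_singleton, Bool.true_eq_false,
    not_false_eq_true, Finset.sum_singleton, if_true, Bool.false_eq_true, if_false, EE_mul] at h
  rw [h]
  simp [EE]

lemma poly_int (a b : ℝ) : ∫ v in a..b, (1 - 2 * v * (1 - v)) =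
    (b - b^2 + 2*b^3/3) - (a - a^2 + 2*a^3/3) := by
  rw [intervalIntegral.integral_eq_sub_of_hasDerivAt
    (f := fun v => v - v^2 + 2*v^3/3)]
  · intro x _
    have := ((hasDerivAt_id x).sub (hasDerivAt_pow 2 x)).add
      (((hasDerivAt_pow 3 x).const_mul 2).div_const 3)
    refine this.congr_deriv ?_
    norm_num
    ring
  · apply Continuous.intervalIntegrable; fun_prop

lemma inner1 {u : ℝ} (h0 : 0 ≤ u) (h : u ≤ 1/2) :
    ∫ v in (0:ℝ)..1, Pfun u v = -u^2 + 4*u^3/3 + 7/12 := by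
  have hc := inner_cont continuous_id u
  simp only [id] at hc
  rw [← intervalIntegral.integral_add_adjacent_intervals (b := 1/2)
      (hc.intervalIntegrable _ _) (hc.intervalIntegrable _ _),
    ← intervalIntegral.integral_add_adjacent_intervals (a := 0) (b := u)
      (hc.intervalIntegrable _ _) (hc.intervalIntegrable _ _)]
  have e1 : ∫ v in (0:ℝ)..u, Pfun u v = ∫ v in (0:ℝ)..u, (1 - 2 * u * (1 - u)) := by
    apply intervalIntegral.integral_congr
    intro v hv
    rw [Set.uIcc_of_le h0] at hv
    have : cmid u v = u := by
      unfold cmid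
      rw [min_eq_right hv.2, max_eq_left hv.2, max_eq_right (hv.2.trans h), min_eq_right h]
    simp only [Pfun, this]
  have e2 : ∫ v in u..(1/2), Pfun u v = ∫ v in u..(1/2), (1 - 2 * v * (1 - v)) := by
    apply intervalIntegral.integral_congr
    intro v hv
    rw [Set.uIcc_of_le h] at hv
    have : cmid u v = v := by
      unfold cmid
      rw [min_eq_left hv.1, max_eq_right hv.1, max_eq_right h, min_eq_right hv.2]
    simp only [Pfun, this]
  have e3 : ∫ v in (1/2:ℝ)..1, Pfun u v = ∫ v in (1/2:ℝ)..1, (1/2:ℝ) := by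
    apply intervalIntegral.integral_congr
    intro v hv
    rw [Set.uIcc_of_le (by norm_num)] at hv
    have : cmid u v = 1/2 := by
      unfold cmid
      rw [min_eq_left (h.trans hv.1), max_eq_right (h.trans hv.1), max_eq_right h,
        min_eq_left hv.1]
    simp only [Pfun, this]
    norm_num
  rw [e1, e2, e3, poly_int]
  simp only [intervalIntegral.integral_const, smul_eq_mul]
  ring

lemma inner2 {u : ℝ} (h0 : 1/2 ≤ u) (h : u ≤ 1) :
    ∫ v in (0:ℝ)..1, Pfun u v = 11/12 - 2*u + 3*u^2 - 4*u^3/3 := by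
  have hc := inner_cont continuous_id u
  simp only [id] at hc
  rw [← intervalIntegral.integral_add_adjacent_intervals (b := 1/2)
      (hc.intervalIntegrable _ _) (hc.intervalIntegrable _ _),
    ← intervalIntegral.integral_add_adjacent_intervals (a := 1/2) (b := u)
      (hc.intervalIntegrable _ _) (hc.intervalIntegrable _ _)]
  have e1 : ∫ v in (0:ℝ)..(1/2), Pfun u v = ∫ v in (0:ℝ)..(1/2), (1/2:ℝ) := by
    apply intervalIntegral.integral_congr
    intro v hv
    rw [Set.uIcc_of_le (by norm_num)] at hv
    have : cmid u v = 1/2 := by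
      unfold cmid
      rw [min_eq_right (hv.2.trans h0), max_eq_left (hv.2.trans h0), max_eq_right hv.2,
        min_eq_left h0]
    simp only [Pfun, this]
    norm_num
  have e2 : ∫ v in (1/2)..u, Pfun u v = ∫ v in (1/2)..u, (1 - 2 * v * (1 - v)) := by
    apply intervalIntegral.integral_congr
    intro v hv
    rw [Set.uIcc_of_le h0] at hv
    have : cmid u v = v := by
      unfold cmid
      rw [min_eq_right hv.2, max_eq_left hv.2, max_eq_left hv.1, min_eq_left hv.2]
    simp only [Pfun, this]
  have e3 : ∫ v in u..1, Pfun u v = ∫ v in u..1, (1 - 2 * u * (1 - u)) := by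
    apply intervalIntegral.integral_congr
    intro v hv
    rw [Set.uIcc_of_le h] at hv
    have : cmid u v = u := by
      unfold cmid
      rw [min_eq_left hv.1, max_eq_right hv.1, max_eq_left h0, min_eq_left hv.1]
    simp only [Pfun, this]
  rw [e1, e2, e3, poly_int]
  simp only [intervalIntegral.integral_const, smul_eq_mul]
  ring

lemma EE_id : EE (fun p => p) = 13/24 := by
  unfold EE
  have hc := outer_cont continuous_id
  simp only [id] at hc
  rw [← intervalIntegral.integral_add_adjacent_intervals (b := 1/2)
      (hc.intervalIntegrable _ _) (hc.intervalIntegrable _ _)]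
  have e1 : ∫ u in (0:ℝ)..(1/2), ∫ v in (0:ℝ)..1, Pfun u v
      = ∫ u in (0:ℝ)..(1/2), (-u^2 + 4*u^3/3 + 7/12) := by
    apply intervalIntegral.integral_congr
    intro u hu
    rw [Set.uIcc_of_le (by norm_num)] at hu
    exact inner1 hu.1 hu.2
  have e2 : ∫ u in (1/2:ℝ)..1, ∫ v in (0:ℝ)..1, Pfun u v
      = ∫ u in (1/2:ℝ)..1, (11/12 - 2*u + 3*u^2 - 4*u^3/3) := by
    apply intervalIntegral.integral_congr
    intro u hu
    rw [Set.uIcc_of_le (by norm_num)] at hu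
    exact inner2 hu.1 hu.2
  have d1 : ∫ u in (0:ℝ)..(1/2), (-u^2 + 4*u^3/3 + 7/12) = 13/48 := by
    rw [intervalIntegral.integral_eq_sub_of_hasDerivAt
      (f := fun u => -(u^3)/3 + u^4/3 + u*(7/12))]
    · norm_num
    · intro x _
      have := (((hasDerivAt_pow 3 x).neg.div_const 3).add ((hasDerivAt_pow 4 x).div_const 3)).add
        ((hasDerivAt_id x).mul_const (7/12))
      refine this.congr_deriv ?_
      norm_num
      ring
    · apply Continuous.intervalIntegrable; fun_prop
  have d2 : ∫ u in (1/2:ℝ)..1, (11/12 - 2*u + 3*u^2 - 4*u^3/3) = 13/48 := by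
    rw [intervalIntegral.integral_eq_sub_of_hasDerivAt
      (f := fun u => u*(11/12) - u^2 + u^3 - u^4/3)]
    · norm_num
    · intro x _
      have := ((((hasDerivAt_id x).mul_const (11/12)).sub (hasDerivAt_pow 2 x)).add
        (hasDerivAt_pow 3 x)).sub ((hasDerivAt_pow 4 x).div_const 3)
      refine this.congr_deriv ?_
      norm_num
    · apply Continuous.intervalIntegrable; fun_prop
  rw [e1, e2, d1, d2]
  norm_num

lemma pgf_eq (n m : ℕ) (y : ℝ) :
    mixedBinomPGF n m y = EE (fun p => (1 + 2 * p / n * (y - 1)) ^ m) := by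
  unfold mixedBinomPGF
  rw [tsum_eq_sum (s := Finset.range (m+1))]
  · have h1 : ∀ k, mixedBinomPMF n m k * y ^ k = EE (fun p =>
        (Nat.choose m k : ℝ) * (2 * p / n) ^ k * (1 - 2 * p / n) ^ (m - k) * y ^ k) := by
      intro k
      rw [EE_mul (fun p => (Nat.choose m k : ℝ) * (2 * p / n) ^ k * (1 - 2 * p / n) ^ (m - k))]
      rfl
    simp only [h1]
    rw [← EE_sum]
    · congr 1
      ext p
      have : 1 + 2 * p / n * (y - 1) = (2 * p / n * y) + (1 - 2 * p / n) := by ring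
      rw [this, add_pow]
      refine Finset.sum_congr rfl fun k _ => ?_
      rw [mul_pow]; ring
    · intro k; fun_prop
  · intro k hk
    have : m < k := by simpa using hk
    simp [mixedBinomPMF, Nat.choose_eq_zero_of_lt this]

lemma pgf_bounds (n m : ℕ) (hn : 2 ≤ n) (hm : (m:ℝ)/n ≤ 12/13) (t : ℝ)
    (ht : 0 ≤ t) (ht1 : t ≤ 1/2) :
    1 + 13/12 * ((m:ℝ)/n) * t ≤ mixedBinomPGF n m (1 + t) ∧
    mixedBinomPGF n m (1 + t) ≤ 1 + 13/12 * ((m:ℝ)/n) * t + 4 * t^2 := by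
  have hn0 : (0:ℝ) < n := by positivity
  have hmn : 0 ≤ (m:ℝ)/n := by positivity
  rw [pgf_eq]
  constructor
  · have := EE_affine (2 * ((m:ℝ)/n) * t) 1
    rw [EE_id] at this
    calc _ = EE (fun p => 1 + p * (2 * ((m:ℝ)/n) * t)) := by rw [this]; ring
      _ ≤ _ := by
        refine EE_mono (by fun_prop) (by fun_prop) fun p hp _ => ?_
        have h0 : 0 ≤ 2 * p / n * t := by positivity
        have := one_add_mul_le_pow (a := 2 * p / n * t) (by linarith) m
        calc _ = 1 + (m:ℝ) * (2 * p / n * t) := by ring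
          _ ≤ _ := this
          _ = _ := by ring
  · have := EE_affine (2 * ((m:ℝ)/n) * t) (1 + 4 * t^2)
    rw [EE_id] at this
    calc _ ≤ EE (fun p => (1 + 4 * t^2) + p * (2 * ((m:ℝ)/n) * t)) := by
          refine EE_mono (by fun_prop) (by fun_prop) fun p hp hp1 => ?_
          have h0 : 0 ≤ 2 * p / n * t := by positivity
          set x := 2 * p * ((m:ℝ)/n) * t with hx
          have hx0 : 0 ≤ x := by positivity
          have hx2 : x ≤ 2 * t := by
            have : 2 * p * ((m:ℝ)/n) ≤ 2 := by nlinarith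
            exact mul_le_mul_of_nonneg_right this ht
          have hexp : (1 + 2 * p / n * (1 + t - 1)) ^ m ≤ Real.exp x := by
            have : x = m * (2 * p / n * t) := by rw [hx]; ring
            rw [this, Real.exp_nat_mul]
            have h2 := Real.add_one_le_exp (2 * p / n * t)
            rw [add_sub_cancel_left]
            exact pow_le_pow_left₀ (by linarith) (by linarith) m
          have h3 := Real.abs_exp_sub_one_sub_id_le (x := x) (by rw [abs_of_nonneg hx0]; linarith)
          have h4 := (abs_le.1 h3).2
          have : p * (2 * ((m:ℝ)/n) * t) = x := by rw [hx]; ring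
          rw [this]
          nlinarith
      _ = _ := by rw [this]; ring

/-- For every `ε > 0` there exist `δ > 0` and `C ≥ 1` such that for all `n ≥ 2`, `m ≥ 1`
with `1/2 ≤ (13/12)(m/n) ≤ 1 − ε`, every `a : ℕ` and every real `α > 0` with `α ≥ C·a`,
there is a `y` with `1 < g_B(y) < y ≤ 2` and `g_B(y)^α / y^{α−a} ≤ e^{−δα}`, where `g_B`
is the probability generating function of `B ∼ Bin(m, 2P/n)`. -/
theorem stmt_14 (ε : ℝ) (hε : 0 < ε) :
    ∃ δ : ℝ, 0 < δ ∧ ∃ C : ℝ, 1 ≤ C ∧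
      ∀ n m : ℕ, 2 ≤ n → 1 ≤ m →
        1 / 2 ≤ 13 / 12 * ((m : ℝ) / n) → 13 / 12 * ((m : ℝ) / n) ≤ 1 - ε →
        ∀ a : ℕ, ∀ α : ℝ, 0 < α → C * a ≤ α →
          ∃ y : ℝ, 1 < mixedBinomPGF n m y ∧ mixedBinomPGF n m y < y ∧ y ≤ 2 ∧
            mixedBinomPGF n m y ^ α / y ^ (α - (a : ℝ)) ≤ Real.exp (-δ * α) := by

  set e := min ε 1 with he
  have he0 : 0 < e := lt_min hε one_pos
  have he1 : e ≤ 1 := min_le_right _ _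
  have heε : e ≤ ε := min_le_left _ _
  set t := e / 8 with ht
  have ht0 : 0 < t := by positivity
  set r := (1 + (1 - e/2) * t) / (1 + t) with hr
  have hr0 : 0 < r := by
    apply div_pos <;> nlinarith
  have hr1 : r < 1 := by
    rw [hr, div_lt_one (by linarith)]
    nlinarith
  have hlog : Real.log r < 0 := Real.log_neg hr0 hr1
  set δ := -Real.log r / 2 with hδ
  have hδ0 : 0 < δ := by rw [hδ]; linarith
  refine ⟨δ, hδ0, max 1 (Real.log 2 / δ), le_max_left _ _, ?_⟩
  intro n m hn hm hl hu a α hα ha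
  have hmn : (m:ℝ)/n ≤ 12/13 := by linarith
  obtain ⟨b1, b2⟩ := pgf_bounds n m hn hmn t ht0.le (by linarith)
  set g := mixedBinomPGF n m (1 + t) with hg
  have hg1 : 1 < g := by nlinarith
  have hgr : g ≤ 1 + (1 - e/2) * t := by
    have : 13 / 12 * ((m:ℝ)/n) * t ≤ (1 - e) * t :=
      mul_le_mul_of_nonneg_right (by linarith) ht0.le
    have h8 : e = 8 * t := by rw [ht]; ring
    rw [h8] at this ⊢
    nlinarith
  have hgy : g < 1 + t := by nlinarith
  refine ⟨1 + t, hg1, hgy, by linarith, ?_⟩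
  have hy0 : 0 < 1 + t := by linarith
  have hg0 : 0 < g := by linarith
  have hlg : Real.log g - Real.log (1 + t) ≤ -2 * δ := by
    rw [← Real.log_div hg0.ne' hy0.ne']
    have : Real.log (g / (1 + t)) ≤ Real.log r :=
      Real.log_le_log (by positivity) (by rw [hr]; gcongr)
    rw [hδ]; linarith
  have hly : Real.log (1 + t) ≤ Real.log 2 := Real.log_le_log hy0 (by linarith)
  have hCa : Real.log 2 * a ≤ δ * α := by
    have h1 : Real.log 2 / δ * a ≤ α :=
      (mul_le_mul_of_nonneg_right (le_max_right _ _) (Nat.cast_nonneg a)).trans ha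
    have h2 := mul_le_mul_of_nonneg_left h1 hδ0.le
    calc _ = δ * (Real.log 2 / δ * a) := by field_simp
      _ ≤ _ := h2
  rw [Real.rpow_def_of_pos hg0, Real.rpow_def_of_pos hy0, ← Real.exp_sub]
  apply Real.exp_le_exp.2
  have h1 := mul_le_mul_of_nonneg_right hlg hα.le
  have h2 := mul_le_mul_of_nonneg_right hly (Nat.cast_nonneg (α := ℝ) a)
  nlinarith
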